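/- Let G be the graph on vertices x_1,…,x_{2n+2} whose edges are those of the cycle C_{2n+1} on x_1,…,x_{2n+1} together with the single additional edge {x_1, x_{2n+2}}, and let I = I(G). Then for every t ≥ 1, I^t = (L(t)) and consequently I^(t) = I^t + (D(t)). -/

import Mathlib

open MvPolynomial

noncomputable section

/-- The ideal generated by the variables indexed by `S`. -/
def varIdeal (K : Type*) [Field K] (N : ℕ) (S : Finset (Fin N)) :
    Ideal (MvPolynomial (Fin N) K) :=
  Ideal.span ((fun i => (X i : MvPolynomial (Fin N) K)) '' S)

/-- The edge ideal of a graph `G`, generated by `X i * X j` for edges `{i, j}`. -/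
def edgeIdeal (K : Type*) [Field K] {N : ℕ} (G : SimpleGraph (Fin N)) :
    Ideal (MvPolynomial (Fin N) K) :=
  Ideal.span {p | ∃ i j, G.Adj i j ∧ p = X i * X j}

/-- `S` is a vertex cover of `G`: every edge meets `S`. -/
def IsVertexCover {N : ℕ} (G : SimpleGraph (Fin N)) (S : Finset (Fin N)) : Prop :=
  ∀ ⦃i j : Fin N⦄, G.Adj i j → i ∈ S ∨ j ∈ S

/-- `S` is a minimal vertex cover of `G`. -/
def IsMinVertexCover {N : ℕ} (G : SimpleGraph (Fin N)) (S : Finset (Fin N)) : Prop :=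
  IsVertexCover G S ∧ ∀ T ⊂ S, ¬ IsVertexCover G T

/-- The `t`-th symbolic power of the edge ideal of `G`:
the intersection of the `t`-th powers of the minimal vertex cover primes. -/
def symbolicPower (K : Type*) [Field K] {N : ℕ} (G : SimpleGraph (Fin N)) (t : ℕ) :
    Ideal (MvPolynomial (Fin N) K) :=
  ⨅ (S : Finset (Fin N)) (_ : IsMinVertexCover G S), varIdeal K N S ^ t

/-- The cycle graph on `Fin m`, with edges `{i, i+1 mod m}`. -/
def cycleGraph (m : ℕ) : SimpleGraph (Fin m) :=
  SimpleGraph.fromRel (fun i j => (j : ℕ) = ((i : ℕ) + 1) % m)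

/-- The set `L(t)` of monomials of degree at least `2t` whose weight with respect to every
minimal vertex cover is at least `t`. -/
def Lset (K : Type*) [Field K] {N : ℕ} (G : SimpleGraph (Fin N)) (t : ℕ) :
    Set (MvPolynomial (Fin N) K) :=
  {p | ∃ a : Fin N →₀ ℕ, p = monomial a 1 ∧ 2 * t ≤ ∑ i, a i ∧
    ∀ S : Finset (Fin N), IsMinVertexCover G S → t ≤ ∑ i ∈ S, a i}

/-- The set `D(t)` of monomials of degree less than `2t` whose weight with respect to every
minimal vertex cover is at least `t`. -/
def Dset (K : Type*) [Field K] {N : ℕ} (G : SimpleGraph (Fin N)) (t : ℕ) :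
    Set (MvPolynomial (Fin N) K) :=
  {p | ∃ a : Fin N →₀ ℕ, p = monomial a 1 ∧ (∑ i, a i) < 2 * t ∧
    ∀ S : Finset (Fin N), IsMinVertexCover G S → t ≤ ∑ i ∈ S, a i}

/-- `α(J)`: the least total degree of a nonzero polynomial in `J`. -/
def alphaDeg {K : Type*} [Field K] {N : ℕ} (J : Ideal (MvPolynomial (Fin N) K)) : ℕ :=
  sInf {d | ∃ f ∈ J, f ≠ 0 ∧ f.totalDegree = d}

/-- The symbolic defect: the minimal number of generators one must add to `I(G)^t`
to obtain the symbolic power `I(G)^(t)`. -/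
def sdefect (K : Type*) [Field K] {N : ℕ} (G : SimpleGraph (Fin N)) (t : ℕ) : ℕ :=
  sInf {c | ∃ F : Finset (MvPolynomial (Fin N) K), F.card = c ∧
    symbolicPower K G t = edgeIdeal K G ^ t + Ideal.span (F : Set (MvPolynomial (Fin N) K))}

/-- The graph consisting of the odd cycle on vertices `0, …, 2n` (that is,
`x_1, …, x_{2n+1}`) together with one extra vertex `2n+1` (that is, `x_{2n+2}`)
joined to vertex `0` (that is, `x_1`) by an edge. -/
def appendedCycle (n : ℕ) : SimpleGraph (Fin (2 * n + 2)) :=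
  SimpleGraph.fromRel (fun i j =>
    ((j : ℕ) = (i : ℕ) + 1 ∧ (j : ℕ) ≤ 2 * n) ∨
    ((i : ℕ) = 2 * n ∧ (j : ℕ) = 0) ∨
    ((i : ℕ) = 0 ∧ (j : ℕ) = 2 * n + 1))

section Helpers

variable {K : Type*} [Field K] {N : ℕ}

/-- Superadditive families of exponent sets control powers of ideals. -/
lemma pow_le_span_of_family (I : Ideal (MvPolynomial (Fin N) K))
    (A : ℕ → Set (Fin N →₀ ℕ)) (h0 : (0 : Fin N →₀ ℕ) ∈ A 0)
    (hadd : ∀ s a b, a ∈ A s → b ∈ A 1 → a + b ∈ A (s + 1))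
    (hI : I ≤ Ideal.span ((fun a => monomial a (1 : K)) '' A 1)) (t : ℕ) :
    I ^ t ≤ Ideal.span ((fun a => monomial a (1 : K)) '' A t) := by
  induction t with
  | zero =>
    have : (1 : MvPolynomial (Fin N) K) ∈
        Ideal.span ((fun a => monomial a (1 : K)) '' A 0) :=
      Ideal.subset_span ⟨0, h0, rfl⟩
    rw [(Ideal.eq_top_iff_one _).2 this]
    exact le_top
  | succ t ih =>
    rw [pow_succ]
    refine (Ideal.mul_mono ih hI).trans ?_
    rw [Ideal.span_mul_span']
    refine Ideal.span_le.2 ?_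
    rintro _ ⟨_, ⟨a, ha, rfl⟩, _, ⟨b, hb, rfl⟩, rfl⟩
    refine Ideal.subset_span ⟨a + b, hadd _ _ _ ha hb, ?_⟩
    simp [monomial_mul]

lemma monomial_mem_varIdeal_pow (S : Finset (Fin N)) (a : Fin N →₀ ℕ) (t : ℕ)
    (h : t ≤ ∑ i ∈ S, a i) : monomial a (1 : K) ∈ varIdeal K N S ^ t := by
  apply Ideal.pow_le_pow_right h
  rw [← Finset.prod_pow_eq_pow_sum]
  have h1 : ∏ i ∈ S, (X i : MvPolynomial (Fin N) K) ^ a i ∈ ∏ i ∈ S, varIdeal K N S ^ a i := by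
    apply Ideal.prod_mem_prod
    intro i hi
    exact Ideal.pow_mem_pow (show X i ∈ varIdeal K N S from Ideal.subset_span ⟨i, hi, rfl⟩) _
  have h2 : monomial a (1 : K) = (∏ i ∈ S, (X i : MvPolynomial (Fin N) K) ^ a i)
      * ∏ i ∈ Finset.univ \ S, (X i : MvPolynomial (Fin N) K) ^ a i := by
    rw [mul_comm, Finset.prod_sdiff (Finset.subset_univ S), monomial_eq]
    simp [Finsupp.prod_fintype]
  rw [h2]
  exact Ideal.mul_mem_right _ _ h1

lemma weight_of_mem_varIdeal_pow (S : Finset (Fin N)) (f : MvPolynomial (Fin N) K) (t : ℕ)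
    (h : f ∈ varIdeal K N S ^ t) (a : Fin N →₀ ℕ) (ha : a ∈ f.support) :
    t ≤ ∑ i ∈ S, a i := by
  have h1 := pow_le_span_of_family (varIdeal K N S)
    (fun s => {a | s ≤ ∑ i ∈ S, a i}) (by simp)
    (by
      intro s a b ha hb
      simp only [Set.mem_ofPred_eq, Finsupp.add_apply, Finset.sum_add_distrib] at *
      omega)
    (by
      refine Ideal.span_le.2 ?_
      rintro _ ⟨i, hi, rfl⟩
      refine Ideal.subset_span ⟨Finsupp.single i 1, ?_, rfl⟩
      simp only [Set.mem_ofPred_eq, Finsupp.single_apply]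
      simp [Finset.mem_coe.1 hi]) t h
  rw [mem_ideal_span_monomial_image] at h1
  obtain ⟨c, hc, hca⟩ := h1 a ha
  exact le_trans hc (Finset.sum_le_sum fun i _ => hca i)

lemma exists_min_cover (G : SimpleGraph (Fin N)) (S : Finset (Fin N))
    (h : IsVertexCover G S) : ∃ T ⊆ S, IsMinVertexCover G T := by
  induction S using Finset.strongInduction with
  | H S ih =>
    by_cases hm : IsMinVertexCover G S
    · exact ⟨S, subset_rfl, hm⟩
    · have : ∃ T ⊂ S, IsVertexCover G T := by
        by_contra hcon
        push Not at hcon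
        exact hm ⟨h, hcon⟩
      obtain ⟨T, hT, hc⟩ := this
      obtain ⟨U, hU, hUm⟩ := ih T hT hc
      exact ⟨U, hU.trans hT.subset, hUm⟩

/-- The monomial with exponent `b` lies in `I ^ t`. -/
def Good (I : Ideal (MvPolynomial (Fin N) K)) (b : Fin N →₀ ℕ) (t : ℕ) : Prop :=
  monomial b (1 : K) ∈ I ^ t

variable {I : Ideal (MvPolynomial (Fin N) K)}

lemma Good.mono {b c : Fin N →₀ ℕ} {t : ℕ} (h : Good I b t) (hbc : b ≤ c) : Good I c t := by
  unfold Good at *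
  have : monomial c (1 : K) = monomial (c - b) 1 * monomial b 1 := by
    rw [monomial_mul, tsub_add_cancel_of_le hbc, one_mul]
  rw [this]
  exact Ideal.mul_mem_left _ _ h

lemma Good.anti {b : Fin N →₀ ℕ} {s t : ℕ} (h : Good I b t) (hst : s ≤ t) : Good I b s :=
  Ideal.pow_le_pow_right hst h

lemma Good.zero (b : Fin N →₀ ℕ) : Good I b 0 := by
  simp [Good]

lemma Good.add_edge {b : Fin N →₀ ℕ} {t : ℕ} (h : Good I b t) (i j : Fin N)
    (hij : (X i * X j : MvPolynomial (Fin N) K) ∈ I) (m : ℕ) :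
    Good I (b + m • (Finsupp.single i 1 + Finsupp.single j 1)) (t + m) := by
  unfold Good at *
  have h1 : monomial (m • (Finsupp.single i 1 + Finsupp.single j 1)) (1 : K)
      = (X i * X j) ^ m := by
    rw [X, X, monomial_mul, monomial_pow]
    simp
  have h2 : monomial (b + m • (Finsupp.single i 1 + Finsupp.single j 1)) (1 : K)
      = monomial b 1 * (X i * X j) ^ m := by
    rw [← h1, monomial_mul, one_mul]
  rw [h2, pow_add]
  exact Ideal.mul_mem_mul h (Ideal.pow_mem_pow hij m)

lemma sum_add_edge (S : Finset (Fin N)) (c : Fin N →₀ ℕ) (p q : Fin N) (m : ℕ) :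
    ∑ i ∈ S, (c + m • (Finsupp.single p 1 + Finsupp.single q 1) : Fin N →₀ ℕ) i
      = ∑ i ∈ S, c i + m * ((if p ∈ S then 1 else 0) + (if q ∈ S then 1 else 0)) := by
  simp only [Finsupp.add_apply, Finsupp.smul_apply, Finset.sum_add_distrib, smul_eq_mul,
    ← Finset.mul_sum, Finsupp.single_apply, Finset.sum_ite_eq]

/-- Removing a leaf edge greedily. -/
lemma leaf_step (P : Finset (Fin N) → Prop) (hmono : ∀ S T, S ⊆ T → P S → P T)
    (p q : Fin N) (hpq : p ≠ q) (herase : ∀ S, P S → P (S.erase p))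
    (b : Fin N →₀ ℕ) (t : ℕ)
    (hb : ∀ S, P S → (p ∈ S ∨ q ∈ S) → t ≤ ∑ i ∈ S, b i) :
    ∃ (c : Fin N →₀ ℕ) (m : ℕ),
      b = c + m • (Finsupp.single p 1 + Finsupp.single q 1) ∧ (c p = 0 ∨ c q = 0) ∧
      ∀ S, P S → t - m ≤ ∑ i ∈ S, c i := by
  obtain ⟨c, m, hbc, hc⟩ : ∃ (c : Fin N →₀ ℕ) (m : ℕ),
      b = c + m • (Finsupp.single p 1 + Finsupp.single q 1) ∧ (c p = 0 ∨ c q = 0) := by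
    refine ⟨b - min (b p) (b q) • (Finsupp.single p 1 + Finsupp.single q 1),
      min (b p) (b q), ?_, ?_⟩
    · ext i
      simp only [Finsupp.add_apply, Finsupp.tsub_apply, Finsupp.smul_apply, smul_eq_mul,
        Finsupp.single_apply]
      by_cases h1 : p = i
      · subst h1
        simp [hpq.symm]
      · by_cases h2 : q = i
        · subst h2
          simp [h1]
        · simp [h1, h2]
    · simp only [Finsupp.tsub_apply, Finsupp.smul_apply, smul_eq_mul, Finsupp.add_apply,
        Finsupp.single_apply]
      simp only [hpq, hpq.symm, if_true, if_false]
      omega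
  refine ⟨c, m, hbc, hc, fun S hS => ?_⟩
  have hE := herase S hS
  have hle : ∑ i ∈ S.erase p, c i ≤ ∑ i ∈ S, c i :=
    Finset.sum_le_sum_of_subset (Finset.erase_subset _ _)
  by_cases hq : q ∈ S
  · have hq' : q ∈ S.erase p := Finset.mem_erase.2 ⟨hpq.symm, hq⟩
    have := hb _ hE (Or.inr hq')
    rw [hbc, sum_add_edge] at this
    simp [hq, hpq.symm] at this
    omega
  · have hq' : q ∉ S.erase p := fun h => hq (Finset.mem_of_mem_erase h)
    rcases hc with hc | hc
    · have := hb (insert p (S.erase p)) (hmono _ _ (Finset.subset_insert _ _) hE)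
        (Or.inl (Finset.mem_insert_self _ _))
      rw [hbc, sum_add_edge, Finset.sum_insert (Finset.notMem_erase p S), hc] at this
      simp only [Finset.mem_insert, hq', hpq.symm, true_or, or_false, if_true, if_false] at this
      omega
    · have := hb (insert q (S.erase p)) (hmono _ _ (Finset.subset_insert _ _) hE)
        (Or.inr (Finset.mem_insert_self _ _))
      rw [hbc, sum_add_edge, Finset.sum_insert hq', hc] at this
      simp only [Finset.mem_insert, Finset.notMem_erase, hpq, true_or, or_false, if_true,
        if_false] at this
      omega

/-- Paths satisfy the König property. -/
lemma path_good (g : ℕ → Fin N) (M : ℕ)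
    (hinj : ∀ i j, i ≤ M → j ≤ M → g i = g j → i = j)
    (hE : ∀ i < M, (X (g i) * X (g (i + 1)) : MvPolynomial (Fin N) K) ∈ I)
    (b : Fin N →₀ ℕ) (t : ℕ)
    (hb : ∀ S : Finset (Fin N), (∀ i < M, g i ∈ S ∨ g (i + 1) ∈ S) → t ≤ ∑ i ∈ S, b i) :
    Good I b t := by
  induction M generalizing b t with
  | zero =>
    have := hb ∅ (by simp)
    simp at this
    subst this
    exact Good.zero b
  | succ M ih =>
    obtain ⟨c, m, hbc, -, hc⟩ := leaf_step
      (fun S => ∀ i < M, g i ∈ S ∨ g (i + 1) ∈ S)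
      (fun S T hST h i hi => (h i hi).imp (fun h => hST h) (fun h => hST h))
      (g (M + 1)) (g M)
      (fun h => by have := hinj _ _ le_rfl (Nat.le_succ M) h; omega)
      (fun S h i hi => (h i hi).imp
        (fun h => Finset.mem_erase.2
          ⟨fun h => by have := hinj _ _ (by omega) (by omega) h; omega, h⟩)
        (fun h => Finset.mem_erase.2
          ⟨fun h => by have := hinj _ _ (by omega) (by omega) h; omega, h⟩))
      b t
      (fun S h1 h2 => hb S (fun i hi => by
        rcases Nat.lt_succ_iff_lt_or_eq.1 hi with h | h
        · exact h1 i h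
        · subst h
          exact h2.symm))
    have h1 := ih (fun i j hi hj => hinj i j (by omega) (by omega))
      (fun i hi => hE i (by omega)) c (t - m) hc
    have h2 := h1.add_edge (g (M + 1)) (g M) (by rw [mul_comm]; exact hE M (by omega)) m
    rw [← hbc] at h2
    exact h2.anti (by omega)

/-- Sum over an interval split in even and odd positions. -/
lemma sum_even_odd (c : ℕ → ℕ) (n : ℕ) :
    ∑ i ∈ Finset.range (2 * n + 1), c i
      = ∑ i ∈ Finset.range (n + 1), c (2 * i) + ∑ i ∈ Finset.range n, c (2 * i + 1) := by
  induction n with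
  | zero => simp
  | succ n ih =>
    rw [show 2 * (n + 1) + 1 = 2 * n + 1 + 1 + 1 by ring, Finset.sum_range_succ,
      Finset.sum_range_succ, ih, Finset.sum_range_succ _ (n + 1), Finset.sum_range_succ _ n]
    rw [Finset.sum_range_succ _ n]
    rw [show 2 * (n + 1) = 2 * n + 1 + 1 by ring]
    ring

/-- The case in which the edge between positions `2n` and `0` can be dropped. -/
lemma neg_case (g : ℕ → Fin N) (n : ℕ)
    (hg : ∀ i j, g i = g j ↔ i % (2 * n + 1) = j % (2 * n + 1))
    (hE : ∀ i, (X (g i) * X (g (i + 1)) : MvPolynomial (Fin N) K) ∈ I)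
    (b : Fin N →₀ ℕ) (t : ℕ)
    (hb : ∀ S : Finset (Fin N), (∀ i, g i ∈ S ∨ g (i + 1) ∈ S) → t ≤ ∑ i ∈ S, b i)
    (hdeg : 2 * t ≤ ∑ i ∈ Finset.range (2 * n + 1), b (g i))
    (hneg : ∑ i ∈ Finset.range (n + 1), b (g (2 * i)) ≤ ∑ i ∈ Finset.range n, b (g (2 * i + 1)))
    (hpre : ∀ j ≤ n, ∑ i ∈ Finset.range j, b (g (2 * i))
      ≤ ∑ i ∈ Finset.range j, b (g (2 * i + 1))) :
    Good I b t := by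
  have hinj : ∀ i j, i ≤ 2 * n → j ≤ 2 * n → g i = g j → i = j := by
    intro i j hi hj h
    rw [hg, Nat.mod_eq_of_lt (by omega), Nat.mod_eq_of_lt (by omega)] at h
    exact h
  -- a path cover which covers the closing edge is a cycle cover
  have hclose : ∀ S : Finset (Fin N), (∀ i < 2 * n, g i ∈ S ∨ g (i + 1) ∈ S) →
      (g (2 * n) ∈ S ∨ g 0 ∈ S) → t ≤ ∑ i ∈ S, b i := by
    intro S h1 h2
    apply hb
    intro i
    have hlt := Nat.mod_lt i (show 0 < 2 * n + 1 by omega)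
    have e1 : g i = g (i % (2 * n + 1)) := (hg _ _).2 (by simp)
    by_cases hi : i % (2 * n + 1) = 2 * n
    · have e2 : g (i + 1) = g 0 := (hg _ _).2 (by rw [← Nat.mod_add_mod, hi]; simp)
      rw [e1, e2, hi]
      exact h2
    · have e2 : g (i + 1) = g (i % (2 * n + 1) + 1) := (hg _ _).2 (by simp [Nat.add_mod])
      rw [e1, e2]
      exact h1 _ (by omega)
  refine path_good g (2 * n) hinj (fun i _ => hE i) b t fun S hS => ?_
  have hodd : ∀ j ≤ n, (∀ i < j, g (2 * i) ∉ S) →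
      (Finset.range j).image (fun i => g (2 * i + 1)) ⊆ S := by
    intro j hj h x hx
    obtain ⟨i, hi, rfl⟩ := Finset.mem_image.1 hx
    have hi := Finset.mem_range.1 hi
    exact (hS (2 * i) (by omega)).resolve_left (h i hi)
  have hsumodd : ∀ j ≤ n, ∑ x ∈ (Finset.range j).image (fun i => g (2 * i + 1)), b x
      = ∑ i ∈ Finset.range j, b (g (2 * i + 1)) := by
    intro j hj
    apply Finset.sum_image
    intro x hx y hy h
    have hx := Finset.mem_range.1 (Finset.mem_coe.1 hx)
    have hy := Finset.mem_range.1 (Finset.mem_coe.1 hy)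
    have := hinj _ _ (by omega) (by omega) h
    omega
  by_cases hex : ∃ j, j ≤ n ∧ g (2 * j) ∈ S
  · classical
    have hspec := Nat.find_spec hex
    have hmin : ∀ i < Nat.find hex, g (2 * i) ∉ S := by
      intro i hi h
      exact Nat.find_min hex hi ⟨by omega, h⟩
    generalize Nat.find hex = j at hspec hmin
    obtain ⟨hj, hjS⟩ := hspec
    by_cases hj0 : j = 0
    · subst hj0
      exact hclose S hS (Or.inr hjS)
    set O := (Finset.range j).image (fun i => g (2 * i + 1)) with hO
    set Ev := (Finset.range j).image (fun i => g (2 * i)) with hEv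
    have hEvmem : ∀ i < j, g (2 * i) ∈ Ev := fun i hi =>
      Finset.mem_image.2 ⟨i, Finset.mem_range.2 hi, rfl⟩
    have hkeep : ∀ i, i ≤ 2 * n → 2 * j ≤ i → g i ∈ S → g i ∈ S \ O := by
      intro i hi hji h
      refine Finset.mem_sdiff.2 ⟨h, fun h' => ?_⟩
      obtain ⟨k, hk, hk'⟩ := Finset.mem_image.1 h'
      have hk := Finset.mem_range.1 hk
      have := hinj _ _ (by omega) (by omega) hk'
      omega
    have hS' : t ≤ ∑ i ∈ (S \ O) ∪ Ev, b i := by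
      apply hclose
      · intro i hi
        by_cases hij : i < 2 * j
        · rcases Nat.even_or_odd' i with ⟨k, rfl | rfl⟩
          · exact Or.inl (Finset.mem_union_right _ (hEvmem k (by omega)))
          · right
            rw [show 2 * k + 1 + 1 = 2 * (k + 1) by ring]
            by_cases hk : k + 1 < j
            · exact Finset.mem_union_right _ (hEvmem (k + 1) hk)
            · have : k + 1 = j := by omega
              rw [this]
              exact Finset.mem_union_left _ (hkeep _ (by omega) le_rfl hjS)
        · exact (hS i hi).imp
            (fun h => Finset.mem_union_left _ (hkeep _ (by omega) (by omega) h))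
            (fun h => Finset.mem_union_left _ (hkeep _ (by omega) (by omega) h))
      · right
        exact Finset.mem_union_right _ (hEvmem 0 (by omega))
    have h1 : ∑ i ∈ (S \ O) ∪ Ev, b i ≤ ∑ i ∈ S \ O, b i + ∑ i ∈ Ev, b i := by
      rw [← Finset.sum_union_inter]
      exact Nat.le_add_right _ _
    have h2 : ∑ i ∈ S \ O, b i + ∑ i ∈ O, b i = ∑ i ∈ S, b i :=
      Finset.sum_sdiff (hodd j hj hmin)
    have h3 : ∑ x ∈ Ev, b x = ∑ i ∈ Finset.range j, b (g (2 * i)) := by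
      apply Finset.sum_image
      intro x hx y hy h
      have hx := Finset.mem_range.1 (Finset.mem_coe.1 hx)
      have hy := Finset.mem_range.1 (Finset.mem_coe.1 hy)
      have := hinj _ _ (by omega) (by omega) h
      omega
    have h4 := hsumodd j hj
    have h5 := hpre j hj
    rw [← hO] at h4
    omega
  · push Not at hex
    have h1 := Finset.sum_le_sum_of_subset (f := fun x => b x)
      (hodd n le_rfl (fun i hi => hex i hi.le))
    have h2 := hsumodd n le_rfl
    have h3 := sum_even_odd (fun i => b (g i)) n
    omega

lemma good_sum (s : Finset ℕ) (y : ℕ → ℕ) (p q : ℕ → Fin N)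
    (hE : ∀ i, (X (p i) * X (q i) : MvPolynomial (Fin N) K) ∈ I) :
    Good I (∑ k ∈ s, y k • (Finsupp.single (p k) 1 + Finsupp.single (q k) 1))
      (∑ k ∈ s, y k) := by
  induction s using Finset.induction_on with
  | empty => exact Good.zero _
  | insert a s ha ih =>
    rw [Finset.sum_insert ha, Finset.sum_insert ha, add_comm, add_comm (y a)]
    exact ih.add_edge _ _ (hE a) _

/-- The case in which all edge weights of the fractional perfect matching are nonnegative. -/
lemma pos_case (g : ℕ → Fin N) (n : ℕ)
    (hg : ∀ i j, g i = g j ↔ i % (2 * n + 1) = j % (2 * n + 1))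
    (hE : ∀ i, (X (g i) * X (g (i + 1)) : MvPolynomial (Fin N) K) ∈ I)
    (b : Fin N →₀ ℕ) (t : ℕ)
    (hdeg : 2 * t ≤ ∑ i ∈ Finset.range (2 * n + 1), b (g i))
    (z : ℕ → ℕ) (hz : ∀ k, z k + z (k + 1) = 2 * b (g k)) (hper : z (2 * n + 1) = z 0) :
    Good I b t := by
  set y : ℕ → ℕ := fun k => if k % 2 = 0 then z k / 2 else (z k + 1) / 2 with hy
  have hload : ∀ k < 2 * n, y k + y (k + 1) = b (g k) := by
    intro k hk
    have := hz k
    simp only [hy]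
    split_ifs <;> omega
  have hy0 : y 0 = z 0 / 2 := by simp [hy]
  have hyn : y (2 * n) = z (2 * n) / 2 := by simp [hy]
  have hlast := hz (2 * n)
  rw [hper] at hlast
  have hgood := good_sum (I := I) (Finset.range (2 * n + 1)) y (fun k => g (k + 2 * n)) g
    (fun i => by
      have := hE (i + 2 * n)
      rwa [show g (i + 2 * n + 1) = g i from
        (hg _ _).2 (by rw [add_assoc, Nat.add_mod_right])] at this)
  have hT : t ≤ ∑ k ∈ Finset.range (2 * n + 1), y k := by
    have h1 : ∑ k ∈ Finset.range (2 * n), b (g k)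
        = ∑ k ∈ Finset.range (2 * n), y k + ∑ k ∈ Finset.range (2 * n), y (k + 1) := by
      rw [← Finset.sum_add_distrib]
      exact Finset.sum_congr rfl fun k hk => (hload k (Finset.mem_range.1 hk)).symm
    have h2 := Finset.sum_range_succ y (2 * n)
    have h3 := Finset.sum_range_succ' y (2 * n)
    have h4 := Finset.sum_range_succ (fun k => b (g k)) (2 * n)
    omega
  refine (hgood.anti hT).mono ?_
  have e1 : ∑ k ∈ Finset.range (2 * n + 1),
      y k • (Finsupp.single (g (k + 2 * n)) 1 + Finsupp.single (g k) 1)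
      = ∑ k ∈ Finset.range (2 * n), Finsupp.single (g k) (y k + y (k + 1))
        + Finsupp.single (g (2 * n)) (y (2 * n) + y 0) := by
    simp only [smul_add, Finsupp.smul_single, smul_eq_mul, mul_one, Finset.sum_add_distrib,
      Finsupp.single_add]
    rw [Finset.sum_range_succ', Finset.sum_range_succ]
    have : ∀ k, g (k + 1 + 2 * n) = g k := fun k =>
      (hg _ _).2 (by rw [show k + 1 + 2 * n = k + (2 * n + 1) by ring, Nat.add_mod_right])
    simp only [this, zero_add]
    abel
  have e2 : ∑ k ∈ Finset.range (2 * n + 1), Finsupp.single (g k) (b (g k)) ≤ b := by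
    rw [← Finset.sum_image (s := Finset.range (2 * n + 1)) (g := g)
      (f := fun x => Finsupp.single x (b x))]
    · intro x
      rw [Finsupp.finsetSum_apply]
      simp only [Finsupp.single_apply, Finset.sum_ite_eq']
      split_ifs
      · exact le_rfl
      · exact Nat.zero_le _
    · intro x hx y hy h
      have hx := Finset.mem_range.1 (Finset.mem_coe.1 hx)
      have hy := Finset.mem_range.1 (Finset.mem_coe.1 hy)
      rwa [hg, Nat.mod_eq_of_lt hx, Nat.mod_eq_of_lt hy] at h
  refine le_trans ?_ e2
  rw [e1, Finset.sum_range_succ]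
  refine add_le_add (Finset.sum_le_sum fun k hk => ?_) ?_
  · rw [hload k (Finset.mem_range.1 hk)]
  · apply Finsupp.single_le_single.2
    omega

/-- The statement for odd cycles. -/
lemma cycle_good (g : ℕ → Fin N) (n : ℕ)
    (hg : ∀ i j, g i = g j ↔ i % (2 * n + 1) = j % (2 * n + 1))
    (hE : ∀ i, (X (g i) * X (g (i + 1)) : MvPolynomial (Fin N) K) ∈ I)
    (b : Fin N →₀ ℕ) (t : ℕ)
    (hb : ∀ S : Finset (Fin N), (∀ i, g i ∈ S ∨ g (i + 1) ∈ S) → t ≤ ∑ i ∈ S, b i)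
    (hdeg : 2 * t ≤ ∑ i ∈ Finset.range (2 * n + 1), b (g i)) :
    Good I b t := by
  have hgp : ∀ k, g (k + (2 * n + 1)) = g k := fun k => (hg _ _).2 (by simp)
  set z : ℕ → ℤ := fun k => ∑ i ∈ Finset.range (n + 1), (b (g (k + 2 * i)) : ℤ)
    - ∑ i ∈ Finset.range n, (b (g (k + 2 * i + 1)) : ℤ) with hzdef
  have hz : ∀ k, z k + z (k + 1) = 2 * b (g k) := by
    intro k
    simp only [hzdef]
    rw [Finset.sum_range_succ', Finset.sum_range_succ (fun i => (b (g (k + 1 + 2 * i)) : ℤ))]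
    have e1 : ∀ i, k + 2 * (i + 1) = k + 1 + 2 * i + 1 := fun i => by ring
    have e2 : ∀ i, k + 1 + 2 * i = k + 2 * i + 1 := fun i => by ring
    have e3 : g (k + 2 * n + 1) = g k := hgp k
    simp only [e1, e2, e3, mul_zero, add_zero]
    ring
  have hzper : ∀ k, z (k + (2 * n + 1)) = z k := by
    intro k
    simp only [hzdef]
    have e1 : ∀ i, g (k + (2 * n + 1) + 2 * i) = g (k + 2 * i) := fun i => by
      rw [← hgp (k + 2 * i)]; congr 1; ring
    have e2 : ∀ i, g (k + (2 * n + 1) + 2 * i + 1) = g (k + 2 * i + 1) := fun i => by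
      rw [← hgp (k + 2 * i + 1)]; congr 1; ring
    simp only [e1, e2]
  by_cases hpos : ∀ k, 0 ≤ z k
  · refine pos_case g n hg hE b t hdeg (fun k => (z k).toNat) (fun k => ?_) ?_
    · have := hz k
      have := hpos k
      have := hpos (k + 1)
      omega
    · have := hzper 0
      rw [zero_add] at this
      simp only [this]
  · push Not at hpos
    obtain ⟨k1, hk1⟩ := hpos
    obtain ⟨k, -, hkmin⟩ := Finset.exists_min_image (Finset.range (2 * n + 1)) z ⟨0, by simp⟩
    have hzmod : ∀ m, z m = z (m % (2 * n + 1)) := by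
      intro m
      have hp : Function.Periodic z (2 * n + 1) := hzper
      exact (hp.map_mod_nat m).symm
    have hmin : ∀ m, z k ≤ z m := by
      intro m
      rw [hzmod m]
      exact hkmin _ (Finset.mem_range.2 (Nat.mod_lt _ (by omega)))
    have hneg : z k < 0 := lt_of_le_of_lt (hmin k1) hk1
    have hstep : ∀ j, z (k + 2 * j) = z k + 2 * (∑ i ∈ Finset.range j, (b (g (k + (2 * i + 1))) : ℤ)
        - ∑ i ∈ Finset.range j, (b (g (k + 2 * i)) : ℤ)) := by
      intro j
      induction j with
      | zero => simp
      | succ j ih =>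
        have h1 := hz (k + 2 * j)
        have h2 := hz (k + 2 * j + 1)
        rw [show k + 2 * (j + 1) = k + 2 * j + 1 + 1 by ring, Finset.sum_range_succ,
          Finset.sum_range_succ, show k + (2 * j + 1) = k + 2 * j + 1 by ring]
        linarith
    refine neg_case (fun i => g (k + i)) n ?_ (fun i => hE (k + i)) b t ?_ ?_ ?_ ?_
    · intro i j
      rw [hg]
      exact ⟨fun h => Nat.ModEq.add_left_cancel' k h, fun h => Nat.ModEq.add_left k h⟩
    · intro S hS
      apply hb
      intro i
      have h := hS (i + 2 * n * k)
      have e1 : g (k + (i + 2 * n * k)) = g i := (hg _ _).2 (by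
        rw [show k + (i + 2 * n * k) = i + (2 * n + 1) * k by ring, Nat.add_mul_mod_self_left])
      have e2 : g (k + (i + 2 * n * k + 1)) = g (i + 1) := (hg _ _).2 (by
        rw [show k + (i + 2 * n * k + 1) = i + 1 + (2 * n + 1) * k by ring,
          Nat.add_mul_mod_self_left])
      rwa [e1, e2] at h
    · refine hdeg.trans (le_of_eq ?_)
      have key : ∀ k, ∑ i ∈ Finset.range (2 * n + 1), b (g (k + i))
          = ∑ i ∈ Finset.range (2 * n + 1), b (g i) := by
        intro k
        induction k with
        | zero => simp
        | succ k ih =>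
          rw [← ih, Finset.sum_range_succ, Finset.sum_range_succ' (fun i => b (g (k + i)))]
          have e1 : g (k + 1 + 2 * n) = g k := by
            rw [← hgp k]; congr 1; ring
          rw [e1, add_zero]
          congr 1
          exact Finset.sum_congr rfl fun i _ => by rw [show k + 1 + i = k + (i + 1) by ring]
      exact (key k).symm
    · have h := hneg
      simp only [hzdef] at h
      have h' : ((∑ i ∈ Finset.range (n + 1), b (g (k + 2 * i)) : ℕ) : ℤ)
          ≤ ((∑ i ∈ Finset.range n, b (g (k + (2 * i + 1))) : ℕ) : ℤ) := by
        push_cast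
        simp only [← add_assoc]
        linarith
      exact_mod_cast h'
    · intro j hj
      have h := hstep j
      have h2 := hmin (k + 2 * j)
      have h' : ((∑ i ∈ Finset.range j, b (g (k + 2 * i)) : ℕ) : ℤ)
          ≤ ((∑ i ∈ Finset.range j, b (g (k + (2 * i + 1))) : ℕ) : ℤ) := by
        push_cast
        linarith
      exact_mod_cast h'

/-- The cycle map. -/
def cyc (n : ℕ) (i : ℕ) : Fin (2 * n + 2) :=
  ⟨i % (2 * n + 1), by have := Nat.mod_lt i (show 0 < 2 * n + 1 by omega); omega⟩

lemma cyc_eq (n i j : ℕ) : cyc n i = cyc n j ↔ i % (2 * n + 1) = j % (2 * n + 1) := by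
  simp [cyc, Fin.ext_iff]

lemma cyc_adj (n : ℕ) (hn : 1 ≤ n) (i : ℕ) :
    (appendedCycle n).Adj (cyc n i) (cyc n (i + 1)) := by
  have hlt := Nat.mod_lt i (show 0 < 2 * n + 1 by omega)
  simp only [appendedCycle, SimpleGraph.fromRel_adj, cyc, ne_eq, Fin.ext_iff]
  by_cases hi : i % (2 * n + 1) = 2 * n
  · have : (i + 1) % (2 * n + 1) = 0 := by
      rw [← Nat.mod_add_mod, hi]; simp
    omega
  · have : (i + 1) % (2 * n + 1) = i % (2 * n + 1) + 1 := by
      rw [← Nat.mod_add_mod, Nat.mod_eq_of_lt (by omega)]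
    omega

lemma cover_of_cyc (n : ℕ) (S : Finset (Fin (2 * n + 2)))
    (h1 : ∀ i, cyc n i ∈ S ∨ cyc n (i + 1) ∈ S)
    (h2 : Fin.last (2 * n + 1) ∈ S ∨ cyc n 0 ∈ S) : IsVertexCover (appendedCycle n) S := by
  have key : ∀ i j : Fin (2 * n + 2),
      (((j : ℕ) = (i : ℕ) + 1 ∧ (j : ℕ) ≤ 2 * n) ∨ ((i : ℕ) = 2 * n ∧ (j : ℕ) = 0) ∨
      ((i : ℕ) = 0 ∧ (j : ℕ) = 2 * n + 1)) → i ∈ S ∨ j ∈ S := by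
    intro i j h
    have h0 : cyc n 0 = ⟨0, by omega⟩ := by simp [cyc]
    rcases h with ⟨h, h'⟩ | ⟨h, h'⟩ | ⟨h, h'⟩
    · have e1 : cyc n i = i := by
        apply Fin.ext; simp only [cyc]; exact Nat.mod_eq_of_lt (by omega)
      have e2 : cyc n (i + 1) = j := by
        apply Fin.ext; simp only [cyc]; rw [h]; exact Nat.mod_eq_of_lt (by omega)
      have := h1 i
      rwa [e1, e2] at this
    · have e1 : cyc n i = i := by
        apply Fin.ext; simp only [cyc]; exact Nat.mod_eq_of_lt (by omega)
      have e2 : cyc n (i + 1) = j := by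
        apply Fin.ext; simp only [cyc]; rw [h, h']; simp
      have := h1 i
      rwa [e1, e2] at this
    · have e1 : cyc n 0 = i := by rw [h0]; apply Fin.ext; simp [h]
      have e2 : Fin.last (2 * n + 1) = j := by apply Fin.ext; simp [h']
      rw [e1, e2] at h2
      exact h2.symm
  intro i j hij
  simp only [appendedCycle, SimpleGraph.fromRel_adj] at hij
  rcases hij.2 with h | h
  · exact key i j h
  · exact (key j i h).symm

lemma appended_good (n t : ℕ) (hn : 1 ≤ n) (b : Fin (2 * n + 2) →₀ ℕ)
    (hdeg : 2 * t ≤ ∑ i, b i)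
    (hb : ∀ S : Finset (Fin (2 * n + 2)), IsMinVertexCover (appendedCycle n) S →
      t ≤ ∑ i ∈ S, b i) :
    Good (edgeIdeal K (appendedCycle n)) b t := by
  have hb' : ∀ S : Finset (Fin (2 * n + 2)), IsVertexCover (appendedCycle n) S →
      t ≤ ∑ i ∈ S, b i := by
    intro S hS
    obtain ⟨T, hT, hTm⟩ := exists_min_cover _ S hS
    exact (hb T hTm).trans (Finset.sum_le_sum_of_subset hT)
  have hE : ∀ i j, (appendedCycle n).Adj i j →
      (X i * X j : MvPolynomial (Fin (2 * n + 2)) K) ∈ edgeIdeal K (appendedCycle n) :=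
    fun i j h => Ideal.subset_span ⟨i, j, h, rfl⟩
  have hcl : ∀ i, cyc n i ≠ Fin.last (2 * n + 1) := by
    intro i h
    have := congrArg Fin.val h
    have hlt := Nat.mod_lt i (show 0 < 2 * n + 1 by omega)
    simp only [cyc, Fin.val_last] at this
    omega
  obtain ⟨c, m, hbc, hc, hcov⟩ := leaf_step
    (fun S => ∀ i, cyc n i ∈ S ∨ cyc n (i + 1) ∈ S)
    (fun S T hST h i => (h i).imp (fun h => hST h) (fun h => hST h))
    (Fin.last (2 * n + 1)) (cyc n 0) (hcl 0).symm
    (fun S h i => (h i).imp (fun h => Finset.mem_erase.2 ⟨hcl _, h⟩)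
      (fun h => Finset.mem_erase.2 ⟨hcl _, h⟩))
    b t (fun S h1 h2 => hb' S (cover_of_cyc n S h1 h2))
  have hlast : (appendedCycle n).Adj (Fin.last (2 * n + 1)) (cyc n 0) := by
    exact (SimpleGraph.fromRel_adj _ _ _).2
      ⟨(hcl 0).symm, Or.inr (Or.inr (Or.inr ⟨by simp [cyc], by simp⟩))⟩
  suffices h : Good (edgeIdeal K (appendedCycle n)) c (t - m) by
    have h2 := h.add_edge _ _ (hE _ _ hlast) m
    rw [← hbc] at h2
    exact h2.anti (by omega)
  rcases hc with hc | hc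
  · refine cycle_good (cyc n) n (cyc_eq n) (fun i => hE _ _ (cyc_adj n hn i)) c (t - m) hcov ?_
    rw [hbc, sum_add_edge, Fin.sum_univ_castSucc, hc] at hdeg
    have : ∑ i ∈ Finset.range (2 * n + 1), c (cyc n i)
        = ∑ i : Fin (2 * n + 1), c i.castSucc := by
      rw [Finset.sum_range]
      refine Finset.sum_congr rfl fun i _ => ?_
      congr 1
      apply Fin.ext
      simp only [cyc, Fin.val_castSucc]
      exact Nat.mod_eq_of_lt i.2
    rw [this]
    simp only [Finset.mem_univ, if_true] at hdeg
    omega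
  · refine path_good (fun i => cyc n (i + 1)) (2 * n - 1) ?_
      (fun i _ => hE _ _ (cyc_adj n hn (i + 1))) c (t - m) ?_
    · intro i j hi hj h
      rw [cyc_eq, Nat.mod_eq_of_lt (by omega), Nat.mod_eq_of_lt (by omega)] at h
      omega
    · intro S hS
      have h1 := hcov (insert (cyc n 0) S) (fun i => by
        have hlt := Nat.mod_lt i (show 0 < 2 * n + 1 by omega)
        have e1 : cyc n i = cyc n (i % (2 * n + 1)) := (cyc_eq _ _ _).2 (by simp)
        have e2 : cyc n (i + 1) = cyc n (i % (2 * n + 1) + 1) :=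
          (cyc_eq _ _ _).2 (by simp [Nat.add_mod])
        rw [e1, e2]
        generalize i % (2 * n + 1) = r at hlt
        by_cases hr : r = 0
        · subst hr
          exact Or.inl (Finset.mem_insert_self _ _)
        by_cases hr2 : r = 2 * n
        · right
          have : cyc n (r + 1) = cyc n 0 := (cyc_eq _ _ _).2 (by rw [hr2]; simp)
          rw [this]
          exact Finset.mem_insert_self _ _
        obtain ⟨s, rfl⟩ := Nat.exists_eq_succ_of_ne_zero hr
        exact (hS s (by omega)).imp (fun h => Finset.mem_insert_of_mem h)
          (fun h => Finset.mem_insert_of_mem h))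
      by_cases h0 : cyc n 0 ∈ S
      · rwa [Finset.insert_eq_of_mem h0] at h1
      · rwa [Finset.sum_insert h0, hc, zero_add] at h1

end Helpers

/-- For the graph obtained from the odd cycle `C_{2n+1}` by appending one extra
vertex joined by a single edge, `I^t = (L(t))` and consequently
`I^(t) = I^t + (D(t))`. -/
theorem appendedCycle_decomposition (K : Type*) [Field K] (n t : ℕ)
    (hn : 1 ≤ n) (ht : 1 ≤ t) :
    edgeIdeal K (appendedCycle n) ^ t = Ideal.span (Lset K (appendedCycle n) t)
    ∧ symbolicPower K (appendedCycle n) t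
        = edgeIdeal K (appendedCycle n) ^ t
          + Ideal.span (Dset K (appendedCycle n) t) := by
  have hmain : edgeIdeal K (appendedCycle n) ^ t
      = Ideal.span (Lset K (appendedCycle n) t) := by
    apply le_antisymm
    · have h := pow_le_span_of_family (edgeIdeal K (appendedCycle n))
        (fun s => {a | 2 * s ≤ ∑ i, a i ∧
          ∀ S : Finset (Fin (2 * n + 2)), IsMinVertexCover (appendedCycle n) S →
            s ≤ ∑ i ∈ S, a i}) (by simp)
        (by
          rintro s a b ⟨ha1, ha2⟩ ⟨hb1, hb2⟩
          simp only [Set.mem_ofPred_eq, Finsupp.add_apply, Finset.sum_add_distrib]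
          refine ⟨by omega, fun S hS => ?_⟩
          have := ha2 S hS
          have := hb2 S hS
          omega)
        (by
          refine Ideal.span_le.2 ?_
          rintro _ ⟨i, j, hij, rfl⟩
          refine Ideal.subset_span ⟨Finsupp.single i 1 + Finsupp.single j 1, ?_, ?_⟩
          · have hs : ∀ S : Finset (Fin (2 * n + 2)),
                ∑ x ∈ S, (Finsupp.single i 1 + Finsupp.single j 1 : Fin (2 * n + 2) →₀ ℕ) x
                = (if i ∈ S then 1 else 0) + (if j ∈ S then 1 else 0) := by
              intro S
              simp [Finset.sum_add_distrib, Finsupp.single_apply]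
            refine ⟨by rw [hs]; simp, fun S hS => ?_⟩
            rw [hs]
            rcases hS.1 hij with h | h
            · rw [if_pos h]; omega
            · rw [if_pos h]; omega
          · simp [X, monomial_mul]) t
      refine h.trans (Ideal.span_mono ?_)
      rintro _ ⟨a, ⟨h1, h2⟩, rfl⟩
      exact ⟨a, rfl, h1, h2⟩
    · refine Ideal.span_le.2 ?_
      rintro _ ⟨a, rfl, h1, h2⟩
      exact appended_good n t hn a h1 h2
  refine ⟨hmain, ?_⟩
  apply le_antisymm
  · intro f hf
    have hf' : ∀ S : Finset (Fin (2 * n + 2)), IsMinVertexCover (appendedCycle n) S →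
        f ∈ varIdeal K (2 * n + 2) S ^ t := by
      intro S hS
      simp only [symbolicPower, Ideal.mem_iInf] at hf
      exact hf S hS
    rw [f.as_sum]
    refine Ideal.sum_mem _ fun a ha => ?_
    have hw : ∀ S : Finset (Fin (2 * n + 2)), IsMinVertexCover (appendedCycle n) S →
        t ≤ ∑ i ∈ S, a i := fun S hS => weight_of_mem_varIdeal_pow S f t (hf' S hS) a ha
    have hc : monomial a (coeff a f) = C (coeff a f) * monomial a (1 : K) := by
      rw [C_mul_monomial, mul_one]
    rw [hc]
    apply Ideal.mul_mem_left
    rcases Nat.lt_or_ge (∑ i, a i) (2 * t) with h | h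
    · exact Ideal.mem_sup_right (Ideal.subset_span ⟨a, rfl, h, hw⟩)
    · rw [hmain]
      exact Ideal.mem_sup_left (Ideal.subset_span ⟨a, rfl, h, hw⟩)
  · refine le_iInf fun S => le_iInf fun hS => sup_le ?_ ?_
    · apply Ideal.pow_right_mono
      refine Ideal.span_le.2 ?_
      rintro _ ⟨i, j, hij, rfl⟩
      rcases hS.1 hij with h | h
      · exact Ideal.mul_mem_right _ _ (Ideal.subset_span ⟨i, h, rfl⟩)
      · exact Ideal.mul_mem_left _ _ (Ideal.subset_span ⟨j, h, rfl⟩)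
    · refine Ideal.span_le.2 ?_
      rintro _ ⟨a, rfl, -, hw⟩
      exact monomial_mem_varIdeal_pow S a t (hw S hS)
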